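/- arXiv:1001.3090 — 2 statements merged into one kernel-verified Lean document; each statement's English description precedes it below -/
import Mathlib

section
/- Let Z be a finite set, let ν ∈ P(Z) have full support, and let E = E(ν, F) be a d-dimensional exponential family with minimal basis {ψ₁,…,ψ_d}. Define N̂(E) = |{ F^ε(Σ_{l=1}^d r_l ψ_l) : r ∈ ℝ^d, ε > 0 }|, the number of distinct sets of the form F^ε applied to functions in the span of the basis. Then N(E) ≤ N̂(E). -/
/-!
STATEMENT 11: `N(E) ≤ N̂(E)`.

For a `d`-dimensional exponential family `E = E(ν, F)` with full-support `ν`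
and minimal basis `ψ₁,…,ψ_d`, `N̂(E)` is the number of distinct sets of the
form `F^ε(Σ_l r_l ψ_l)` with `r ∈ ℝᵈ` and `ε > 0` (here counted by
`Set.ncard`). `N(E)` is encoded below by `distinguishProp`/`NE` exactly as in
the paper: the maximum `N` admitting, for all small `ε > 0`, an ε-extremal
subset of `E` of size `≥ N` whose members are pairwise ε-distinguishable.
-/

noncomputable def expFam {Z : Type*} [Fintype Z] (ν : Z → ℝ)
    (F : Set (Z → ℝ)) : Set (Z → ℝ) :=
  {μ | ∃ f ∈ F, μ = fun z => ν z * Real.exp (f z) / ∑ z', ν z' * Real.exp (f z')}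

noncomputable def Feps {Z : Type*} [Fintype Z] (ε : ℝ) (x : Z → ℝ) : Set Z :=
  {z | (⨆ z', x z') - ε ≤ x z}

def distinguishable {Z : Type*} [Fintype Z] (ε : ℝ) (x y : Z → ℝ) : Prop :=
  (Feps ε x \ Feps ε y).Nonempty ∧ (Feps ε y \ Feps ε x).Nonempty

def extremal {Z : Type*} [Fintype Z] (ε : ℝ) (x : Z → ℝ) : Prop :=
  1 - ε ≤ ∑ z, (Feps ε x).indicator x z

def distinguishProp {Z : Type*} [Fintype Z] (E : Set (Z → ℝ)) (N : ℕ) : Prop :=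
  ∃ ε₀ > (0 : ℝ), ∀ ε : ℝ, 0 < ε → ε < ε₀ →
    ∃ A : Finset (Z → ℝ), ↑A ⊆ E ∧ N ≤ A.card ∧
      (∀ π ∈ A, extremal ε π) ∧
      ∀ π ∈ A, ∀ π' ∈ A, π ≠ π' → distinguishable ε π π'

/-- `N(E)`: the maximum `N` such that `distinguishProp E N` holds. -/
noncomputable def NE {Z : Type*} [Fintype Z] (E : Set (Z → ℝ)) : ℕ :=
  sSup {N : ℕ | distinguishProp E N}

/-- `E` is a `d`-dimensional exponential family on `Z`: `E = E(ν, F)` for some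
full-support `ν ∈ P(Z)` and `F` spanned by a minimal basis `ψ₁,…,ψ_d`. -/
def IsExpFamOfDim {Z : Type*} [Fintype Z] (d : ℕ) (E : Set (Z → ℝ)) : Prop :=
  ∃ ν : Z → ℝ, (∀ z, 0 < ν z) ∧ (∑ z, ν z = 1) ∧
    ∃ ψ : Fin d → Z → ℝ, LinearIndependent ℝ (Fin.cons (1 : Z → ℝ) ψ) ∧
      E = expFam ν {f | ∃ r : Fin d → ℝ, f = fun z => ∑ i, r i * ψ i z}

/-- `N̄(d)`: the maximum of `N(E)` over all `d`-dimensional exponential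
families `E` on `Z`. -/
noncomputable def Nbar (Z : Type*) [Fintype Z] (d : ℕ) : ℕ :=
  sSup {n : ℕ | ∃ E : Set (Z → ℝ), IsExpFamOfDim d E ∧ n = NE E}

theorem exists_eq_Feps_of_isUpperLevel {Z : Type*} [Fintype Z] (f : Z → ℝ) {S : Set Z}
    (hS : S.Nonempty) (hf : ∀ z ∈ S, ∀ w ∉ S, f w < f z) :
    ∃ δ : ℝ, 0 < δ ∧ S = Feps δ f := by
  obtain ⟨a, ha, hamin⟩ := Set.exists_min_image S f S.toFinite hS
  have hmax : ∀ z, f z ≤ ⨆ z', f z' := le_ciSup (Set.finite_range f).bddAbove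
  obtain ⟨t, hta, ht⟩ : ∃ t < f a, ∀ w ∉ S, f w < t := by
    rcases Sᶜ.eq_empty_or_nonempty with hc | hc
    · exact ⟨f a - 1, by linarith, fun w hw => absurd (show w ∈ Sᶜ from hw) (by simp [hc])⟩
    · obtain ⟨b, hb, hbmax⟩ := Set.exists_max_image Sᶜ f Sᶜ.toFinite hc
      obtain ⟨t, hbt, hta⟩ := exists_between (hf a ha b hb)
      exact ⟨t, hta, fun w hw => (hbmax w hw).trans_lt hbt⟩
  refine ⟨(⨆ z', f z') - t, by linarith [hmax a], ?_⟩
  ext z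
  simp only [Feps, Set.mem_ofPred_eq, sub_sub_cancel]
  refine ⟨fun hz => hta.le.trans (hamin z hz), fun hz => ?_⟩
  by_contra hzS
  exact (ht z hzS).not_ge hz

theorem Feps_nonempty {Z : Type*} [Fintype Z] [Nonempty Z] {ε : ℝ} (hε : 0 ≤ ε) (x : Z → ℝ) :
    (Feps ε x).Nonempty := by
  obtain ⟨z, hz⟩ := exists_eq_ciSup_of_finite (f := x)
  exact ⟨z, by simp only [Feps, Set.mem_ofPred_eq]; linarith⟩

theorem extremal.apply_le_of_notMem {Z : Type*} [Fintype Z] {ε : ℝ} {π : Z → ℝ}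
    (h : extremal ε π) (hnonneg : ∀ z, 0 ≤ π z) (hsum : ∑ z, π z = 1) {w : Z}
    (hw : w ∉ Feps ε π) : π w ≤ ε := by
  have hle : π w ≤ ∑ z, (π z - (Feps ε π).indicator π z) := by
    have := Finset.single_le_sum (f := fun z => π z - (Feps ε π).indicator π z)
      (fun z _ => sub_nonneg.2 (Set.indicator_le_self' (fun z _ => hnonneg z) z))
      (Finset.mem_univ w)
    simpa [Set.indicator_of_notMem hw] using this
  rw [Finset.sum_sub_distrib, hsum] at hle
  unfold extremal at h
  linarith

theorem inv_card_le_iSup {Z : Type*} [Fintype Z] [Nonempty Z] {π : Z → ℝ}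
    (hsum : ∑ z, π z = 1) : (Fintype.card Z : ℝ)⁻¹ ≤ ⨆ z, π z := by
  obtain ⟨z, -, hz⟩ := Finset.exists_le_of_sum_le (s := Finset.univ)
    (f := fun _ : Z => (Fintype.card Z : ℝ)⁻¹) (g := π) Finset.univ_nonempty (by simp [hsum])
  exact hz.trans (le_ciSup (Set.finite_range π).bddAbove z)

/-- For small `ε`, the set `Feps ε π` of an `ε`-extremal member `π` of an exponential family is an
upper level set of the function defining `π`. -/
theorem exists_Feps_eq_of_extremal {Z : Type*} [Fintype Z] [Nonempty Z] {ν : Z → ℝ} {m ε : ℝ}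
    (hm : 0 < m) (hmν : ∀ z, m ≤ ν z) (hνsum : ∑ z, ν z = 1) (hε : 0 < ε)
    (hεm : ε < m * (Fintype.card Z : ℝ)⁻¹ / 2) (f : Z → ℝ)
    (h : extremal ε fun z => ν z * Real.exp (f z) / ∑ z', ν z' * Real.exp (f z')) :
    ∃ δ : ℝ, 0 < δ ∧
      Feps ε (fun z => ν z * Real.exp (f z) / ∑ z', ν z' * Real.exp (f z')) = Feps δ f := by
  have hν : ∀ z, 0 < ν z := fun z => hm.trans_le (hmν z)
  have hν1 : ∀ z, ν z ≤ 1 := fun z =>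
    hνsum ▸ Finset.single_le_sum (fun z _ => (hν z).le) (Finset.mem_univ z)
  set W := ∑ z', ν z' * Real.exp (f z') with hW
  have hWpos : 0 < W :=
    Finset.sum_pos (fun z _ => mul_pos (hν z) (Real.exp_pos _)) Finset.univ_nonempty
  set π : Z → ℝ := fun z => ν z * Real.exp (f z) / W with hπ
  have hpos : ∀ z, 0 < π z := fun z => div_pos (mul_pos (hν z) (Real.exp_pos _)) hWpos
  have hsum : ∑ z, π z = 1 := by
    rw [hπ, ← Finset.sum_div, ← hW, div_self hWpos.ne']
  have hexp : ∀ z, Real.exp (f z) = π z * W / ν z := fun z => by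
    have := (hν z).ne'
    simp only [hπ]
    field_simp
  refine exists_eq_Feps_of_isUpperLevel f (Feps_nonempty hε.le π) fun z hz w hw => ?_
  have hwε : π w ≤ ε := h.apply_le_of_notMem (fun z => (hpos z).le) hsum hw
  have hzε : (Fintype.card Z : ℝ)⁻¹ - ε ≤ π z :=
    (sub_le_sub_right (inv_card_le_iSup hsum) ε).trans hz
  have hc : (0 : ℝ) < (Fintype.card Z : ℝ)⁻¹ := by positivity
  have hm1 : m ≤ 1 := (hmν z).trans (hν1 z)
  have hεc : ε ≤ (Fintype.card Z : ℝ)⁻¹ / 2 := by nlinarith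
  rw [← Real.exp_lt_exp, hexp, hexp, div_lt_div_iff₀ (hν w) (hν z)]
  have h₁ : π w * ν z ≤ ε := by nlinarith [hpos w, hν1 z]
  have h₂ : m * ((Fintype.card Z : ℝ)⁻¹ / 2) ≤ ν w * π z :=
    mul_le_mul (hmν w) (by linarith) (by positivity) (hν w).le
  have h₃ : π w * ν z < π z * ν w := by linarith
  nlinarith

theorem NE_le_Nhat {Z : Type*} [Fintype Z] [Nonempty Z] {d : ℕ}
    (ν : Z → ℝ) (hν : ∀ z, 0 < ν z) (hνsum : ∑ z, ν z = 1)
    (ψ : Fin d → Z → ℝ) (hmin : LinearIndependent ℝ (Fin.cons (1 : Z → ℝ) ψ)) :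
    NE (expFam ν {f | ∃ r : Fin d → ℝ, f = fun z => ∑ i, r i * ψ i z}) ≤
      Set.ncard {S : Set Z | ∃ (r : Fin d → ℝ) (ε : ℝ), 0 < ε ∧
        S = Feps ε (fun z => ∑ l, r l * ψ l z)} := by
  have hcard : (0 : ℝ) < (Fintype.card Z : ℝ)⁻¹ := by positivity
  obtain ⟨z₀, hz₀⟩ := Finite.exists_min ν
  refine csSup_le' ?_
  rintro N ⟨ε₀, hε₀, hN⟩
  have hb : 0 < ν z₀ * (Fintype.card Z : ℝ)⁻¹ / 2 := half_pos (mul_pos (hν z₀) hcard)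
  obtain ⟨ε, hε, hlt⟩ := exists_between (lt_min hε₀ hb)
  obtain ⟨A, hAE, hNA, hext, hdist⟩ := hN ε hε (hlt.trans_le (min_le_left _ _))
  refine hNA.trans ?_
  rw [← Set.ncard_coe_finset A]
  refine Set.ncard_le_ncard_of_injOn (Feps ε) (fun π hπ => ?_) (fun π hπ π' hπ' heq => ?_)
    (Set.toFinite _)
  · have hπext := hext π hπ
    obtain ⟨f, ⟨r, rfl⟩, rfl⟩ := hAE hπ
    obtain ⟨δ, hδ, hδeq⟩ := exists_Feps_eq_of_extremal (hν z₀) hz₀ hνsum hε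
      (hlt.trans_le (min_le_right _ _)) _ hπext
    exact ⟨r, δ, hδ, hδeq⟩
  · by_contra hne
    obtain ⟨⟨z, hz, hz'⟩, -⟩ := hdist π hπ π' hπ' hne
    exact hz' (heq ▸ hz)
end

section
/- Let X̄ be a p×n real matrix with rank(X̄) = d, let S = {X ∈ ℝ^{p×n} : rank(X) ≤ d}, let H = {X̄W₁ + W₂X̄ : W₁ ∈ ℝ^{n×n}, W₂ ∈ ℝ^{p×p}}, and let P_H denote the orthogonal projection onto H with respect to the Frobenius inner product. Then there exist δ > 0 and M > 0 such that for any p×n real matrix Y, writing Z = P_H(Y) and taking any X that is a Frobenius-norm-nearest point of S to Y: if ‖Z − X̄‖ ≤ δ, then ‖Z − X‖ ≤ M‖Y − X̄‖^{3/2}. -/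
/-!
STATEMENT 15: Projection error bound.

`fnorm` is the Frobenius norm. `S = {X : rank X ≤ d}` and
`H = {X̄W₁ + W₂X̄}`. The orthogonal projection `Z = P_H(Y)` is characterized
by `Z ∈ H` together with orthogonality (in the Frobenius inner product) of
`Y − Z` to every member of `H`; `X` is any Frobenius-norm-nearest point of
`S` to `Y`. Conclusion: if `‖Z − X̄‖ ≤ δ` then `‖Z − X‖ ≤ M‖Y − X̄‖^{3/2}`.
-/

noncomputable def fnorm {m n : Type*} [Fintype m] [Fintype n]
    (A : Matrix m n ℝ) : ℝ :=
  Real.sqrt (∑ i, ∑ j, A i j ^ 2)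

/-- A matrix of rank at most `d` factors through a `d`-dimensional space. -/
theorem Matrix.exists_eq_mul_of_rank_le {K m n : Type*} [Field K] [Fintype m] [Fintype n]
    [DecidableEq n] {d : ℕ} (X : Matrix m n K) (h : X.rank ≤ d) :
    ∃ (A : Matrix m (Fin d) K) (B : Matrix (Fin d) n K), X = A * B := by
  have h' : Module.finrank K (LinearMap.range X.mulVecLin) ≤ Module.finrank K (Fin d → K) := by
    simpa [Matrix.rank] using h
  obtain ⟨f, hf⟩ := finrank_le_iff_exists_linearMap.mp h'
  obtain ⟨g, hg⟩ := f.exists_leftInverse_of_injective (LinearMap.ker_eq_bot.mpr hf)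
  refine ⟨LinearMap.toMatrix' ((LinearMap.range X.mulVecLin).subtype ∘ₗ g),
    LinearMap.toMatrix' (f ∘ₗ X.mulVecLin.rangeRestrict), ?_⟩
  rw [← LinearMap.toMatrix'_comp, LinearMap.comp_assoc, ← LinearMap.comp_assoc _ f g, hg,
    LinearMap.id_comp]
  exact (LinearMap.toMatrix'_toLin' X).symm

/-- A matrix of full row rank has a right inverse. -/
theorem Matrix.exists_mul_eq_one_of_rank_eq {K n : Type*} [Field K] [Fintype n] {d : ℕ}
    (B : Matrix (Fin d) n K) (h : B.rank = d) : ∃ R : Matrix n (Fin d) K, B * R = 1 := by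
  refine Matrix.mulVec_surjective_iff_exists_right_inverse.mp ?_
  have : LinearMap.range B.mulVecLin = ⊤ :=
    Submodule.eq_top_of_finrank_eq (by simpa [Matrix.rank] using h)
  exact LinearMap.range_eq_top.mp this

/-- A matrix of rank `d` has a factorization through a `d`-dimensional space whose factors are
one-sided invertible. -/
theorem Matrix.exists_rank_factorization {K m n : Type*} [Field K] [Fintype m] [Fintype n]
    [DecidableEq n] {d : ℕ} (X : Matrix m n K) (h : X.rank = d) :
    ∃ (A : Matrix m (Fin d) K) (B : Matrix (Fin d) n K) (A' : Matrix (Fin d) m K)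
      (B' : Matrix n (Fin d) K), X = A * B ∧ A' * A = 1 ∧ B * B' = 1 := by
  obtain ⟨A, B, hX⟩ := X.exists_eq_mul_of_rank_le h.le
  have hA : A.transpose.rank = d := by
    rw [Matrix.rank_transpose]
    refine le_antisymm (by simpa using A.rank_le_card_width) (h.symm.le.trans ?_)
    rw [hX]
    exact Matrix.rank_mul_le_left A B
  have hB : B.rank = d := by
    refine le_antisymm (by simpa using B.rank_le_card_height) (h.symm.le.trans ?_)
    rw [hX]
    exact Matrix.rank_mul_le_right A B
  obtain ⟨R, hR⟩ := A.transpose.exists_mul_eq_one_of_rank_eq hA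
  obtain ⟨B', hB'⟩ := B.exists_mul_eq_one_of_rank_eq hB
  refine ⟨A, B, R.transpose, B', hX, ?_, hB'⟩
  rw [← Matrix.transpose_inj]
  simpa using hR

section Frobenius

attribute [local instance] Matrix.frobeniusNormedAddCommGroup Matrix.frobeniusNormedSpace
  Matrix.frobeniusNormedRing Matrix.frobeniusNormedAlgebra

theorem fnorm_eq_norm {m n : Type*} [Fintype m] [Fintype n] (A : Matrix m n ℝ) :
    fnorm A = ‖A‖ := by
  rw [Matrix.frobenius_norm_def, fnorm, Real.sqrt_eq_rpow]
  simp

theorem frobenius_norm_add_sq {m n : Type*} [Fintype m] [Fintype n] {A B : Matrix m n ℝ}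
    (h : ∑ i, ∑ j, A i j * B i j = 0) : ‖A + B‖ ^ 2 = ‖A‖ ^ 2 + ‖B‖ ^ 2 := by
  simp only [← fnorm_eq_norm, fnorm]
  rw [Real.sq_sqrt (by positivity), Real.sq_sqrt (by positivity), Real.sq_sqrt (by positivity)]
  have : ∑ i, ∑ j, (A + B) i j ^ 2 =
      ∑ i, ∑ j, A i j ^ 2 + ∑ i, ∑ j, B i j ^ 2 + 2 * ∑ i, ∑ j, A i j * B i j := by
    simp only [Finset.mul_sum, ← Finset.sum_add_distrib, Matrix.add_apply]
    exact Finset.sum_congr rfl fun i _ => Finset.sum_congr rfl fun j _ => by ring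
  rw [this, h]
  ring

theorem frobenius_norm_mul_le_of_le {l m n : Type*} [Fintype l] [Fintype m] [Fintype n]
    {A : Matrix l m ℝ} {B : Matrix m n ℝ} {a b : ℝ} (hA : ‖A‖ ≤ a) (hB : ‖B‖ ≤ b) :
    ‖A * B‖ ≤ a * b :=
  (Matrix.frobenius_norm_mul A B).trans
    (mul_le_mul hA hB (norm_nonneg B) ((norm_nonneg A).trans hA))

/-- A small perturbation of the identity has an inverse of norm at most `2 * ‖1‖`. -/
theorem exists_inverse_one_add {m : Type*} [Fintype m] [DecidableEq m] {E : Matrix m m ℝ}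
    (hE : ‖E‖ ≤ 1 / 2) :
    ∃ U : Matrix m m ℝ, (1 + E) * U = 1 ∧ ‖U‖ ≤ 2 * ‖(1 : Matrix m m ℝ)‖ := by
  have : CompleteSpace (Matrix m m ℝ) := FiniteDimensional.complete ℝ _
  have hu : IsUnit (1 - -E) := isUnit_one_sub_of_norm_lt_one (by rw [norm_neg]; linarith)
  rw [sub_neg_eq_add] at hu
  obtain ⟨U, hU⟩ := hu.exists_right_inv
  refine ⟨U, hU, ?_⟩
  have h1 : U = 1 - E * U := by rw [← hU]; noncomm_ring
  have h2 : ‖U‖ ≤ ‖(1 : Matrix m m ℝ)‖ + ‖E * U‖ := by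
    conv_lhs => rw [h1]
    exact norm_sub_le _ _
  have h3 := frobenius_norm_mul_le_of_le hE (le_refl ‖U‖)
  linarith

variable {p n d : ℕ}

/-- Matrices of rank at most `d` near a matrix `Xbar` of rank `d` are quadratically close to
the affine tangent space at `Xbar`. -/
theorem exists_tangent_approx (Xbar : Matrix (Fin p) (Fin n) ℝ) (hrank : Xbar.rank = d) :
    ∃ ε > (0 : ℝ), ∃ c ≥ (0 : ℝ), ∀ X : Matrix (Fin p) (Fin n) ℝ, X.rank ≤ d →
      ‖X - Xbar‖ ≤ ε → ∃ (W₁ : Matrix (Fin n) (Fin n) ℝ) (W₂ : Matrix (Fin p) (Fin p) ℝ),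
        ‖X - (Xbar * W₁ + W₂ * Xbar)‖ ≤ c * ‖X - Xbar‖ ^ 2 := by
  obtain ⟨L, R, L', R', hX, hL, hR⟩ := Xbar.exists_rank_factorization hrank
  set P := 1 - L * L' with hP
  set Q := 1 - R' * R with hQ
  have hPL : P * L = 0 := by
    rw [hP, Matrix.sub_mul, Matrix.mul_assoc, hL, Matrix.one_mul, Matrix.mul_one, sub_self]
  have hRQ : R * Q = 0 := by
    rw [hQ, Matrix.mul_sub, ← Matrix.mul_assoc, hR, Matrix.one_mul, Matrix.mul_one, sub_self]
  refine ⟨1 / (2 * (‖L'‖ * ‖R'‖ + 1)), by positivity,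
    ‖P‖ * ‖R'‖ * (2 * ‖(1 : Matrix (Fin d) (Fin d) ℝ)‖) * ‖L'‖ * ‖Q‖, by positivity,
    fun X hXd hXe => ?_⟩
  set F := X - Xbar with hF
  have hXF : X = Xbar + F := by rw [hF]; abel
  have hE : ‖L' * F * R'‖ ≤ 1 / 2 := by
    have h1 := frobenius_norm_mul_le_of_le
      (frobenius_norm_mul_le_of_le (le_refl ‖L'‖) hXe) (le_refl ‖R'‖)
    refine h1.trans ?_
    rw [mul_one_div, div_mul_eq_mul_div, div_le_div_iff₀ (by positivity) two_pos]
    linarith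
  obtain ⟨U, hU, hUn⟩ := exists_inverse_one_add hE
  have hT : 1 + L' * F * R' = L' * X * R' := by
    rw [hXF, Matrix.mul_add, Matrix.add_mul, hX, ← Matrix.mul_assoc L' L R, hL, Matrix.one_mul, hR]
  rw [hT] at hU
  have hXX : X * (R' * U * L') * X = X := by
    obtain ⟨A, B, hAB⟩ := X.exists_eq_mul_of_rank_le hXd
    rw [hAB] at hU
    have h1 : (L' * A) * (B * R' * U) = 1 := by rw [← hU]; simp only [Matrix.mul_assoc]
    have h2 := mul_eq_one_comm.mp h1
    calc X * (R' * U * L') * X = A * ((B * R' * U) * (L' * A)) * B := by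
          rw [hAB]; simp only [Matrix.mul_assoc]
      _ = X := by rw [h2, Matrix.mul_one, hAB]
  have hPX : P * X = P * F := by
    rw [hXF, Matrix.mul_add, hX, ← Matrix.mul_assoc, hPL, Matrix.zero_mul, zero_add]
  have hXQ : X * Q = F * Q := by
    rw [hXF, Matrix.add_mul, hX, Matrix.mul_assoc, hRQ, Matrix.mul_zero, zero_add]
  have key : P * X * Q = P * F * (R' * U * L') * (F * Q) := by
    conv_lhs => rw [← hXX]
    rw [← hPX, ← hXQ]
    simp only [Matrix.mul_assoc]
  have hXbarR : Xbar * R' = L := by rw [hX, Matrix.mul_assoc, hR, Matrix.mul_one]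
  have hLXbar : L' * Xbar = R := by rw [hX, ← Matrix.mul_assoc, hL, Matrix.one_mul]
  refine ⟨R' * L' * X, P * X * R' * L', ?_⟩
  have hres : X - (Xbar * (R' * L' * X) + P * X * R' * L' * Xbar) = P * X * Q := by
    have h1 : Xbar * (R' * L' * X) = L * L' * X := by
      rw [← hXbarR]; simp only [Matrix.mul_assoc]
    have h2 : P * X * R' * L' * Xbar = P * X * (R' * R) := by
      rw [← hLXbar]; simp only [Matrix.mul_assoc]
    rw [h1, h2, hQ, Matrix.mul_sub, Matrix.mul_one, ← sub_sub]
    congr 1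
    rw [hP, Matrix.sub_mul, Matrix.one_mul]
  rw [hres, key]
  refine (frobenius_norm_mul_le_of_le (frobenius_norm_mul_le_of_le
    (Matrix.frobenius_norm_mul P F) (frobenius_norm_mul_le_of_le
      (frobenius_norm_mul_le_of_le (le_refl ‖R'‖) hUn) (le_refl ‖L'‖)))
    (Matrix.frobenius_norm_mul F Q)).trans (le_of_eq ?_)
  ring

/-- Points of the tangent space at `Xbar` are quadratically close to matrices of rank at most
`d`. -/
theorem exists_rank_le_approx (Xbar : Matrix (Fin p) (Fin n) ℝ) (hrank : Xbar.rank = d) :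
    ∃ c ≥ (0 : ℝ), ∀ (W₁ : Matrix (Fin n) (Fin n) ℝ) (W₂ : Matrix (Fin p) (Fin p) ℝ),
      ∃ V : Matrix (Fin p) (Fin n) ℝ, V.rank ≤ d ∧
        ‖V - (Xbar + (Xbar * W₁ + W₂ * Xbar))‖ ≤ c * ‖Xbar * W₁ + W₂ * Xbar‖ ^ 2 := by
  obtain ⟨L, R, L', R', hX, hL, hR⟩ := Xbar.exists_rank_factorization hrank
  set G := R' * L' with hG
  have hXG : Xbar * G * Xbar = Xbar := by
    calc Xbar * G * Xbar = L * ((R * R') * (L' * L)) * R := by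
          rw [hX, hG]; simp only [Matrix.mul_assoc]
      _ = Xbar := by rw [hR, hL, Matrix.mul_one, Matrix.mul_one, hX]
  set P := 1 - Xbar * G with hP
  refine ⟨‖P‖ * ‖G‖ * ‖Xbar‖ * ‖G‖, by positivity, fun W₁ W₂ => ?_⟩
  set E := Xbar * W₁ + W₂ * Xbar with hE
  have hE' : E = Xbar * (G * E) + P * E * G * Xbar := by
    have h1 : Xbar * (G * E) = Xbar * W₁ + Xbar * G * W₂ * Xbar := by
      calc Xbar * (G * E) = Xbar * G * Xbar * W₁ + Xbar * G * W₂ * Xbar := by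
            rw [hE]; simp only [Matrix.mul_add, Matrix.mul_assoc]
        _ = _ := by rw [hXG]
    have hPX : P * Xbar = 0 := by rw [hP, Matrix.sub_mul, hXG, Matrix.one_mul, sub_self]
    have h2 : P * E * G * Xbar = P * W₂ * Xbar := by
      calc P * E * G * Xbar = (P * Xbar) * (W₁ * G * Xbar) + P * W₂ * (Xbar * G * Xbar) := by
            rw [hE]; simp only [Matrix.mul_add, Matrix.add_mul, Matrix.mul_assoc]
        _ = _ := by rw [hPX, hXG, Matrix.zero_mul, zero_add]
    rw [h1, h2, hP, Matrix.sub_mul, Matrix.sub_mul, Matrix.one_mul, hE]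
    abel
  refine ⟨(1 + P * E * G) * Xbar * (1 + G * E), ?_, ?_⟩
  · exact (Matrix.rank_mul_le_left _ _).trans ((Matrix.rank_mul_le_right _ _).trans hrank.le)
  · have hV : (1 + P * E * G) * Xbar * (1 + G * E) - (Xbar + E)
        = P * E * G * Xbar * (G * E) := by
      conv_lhs => enter [2, 2]; rw [hE']
      simp only [Matrix.add_mul, Matrix.mul_add, Matrix.one_mul, Matrix.mul_one]
      abel
    rw [hV]
    refine (frobenius_norm_mul_le_of_le (frobenius_norm_mul_le_of_le
      (frobenius_norm_mul_le_of_le (Matrix.frobenius_norm_mul P E) (le_refl ‖G‖))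
      (le_refl ‖Xbar‖)) (Matrix.frobenius_norm_mul G E)).trans (le_of_eq ?_)
    ring

end Frobenius

set_option maxHeartbeats 1000000 in
theorem projection_error_bound {p n d : ℕ}
    (Xbar : Matrix (Fin p) (Fin n) ℝ) (hrank : Xbar.rank = d) :
    ∃ δ > (0 : ℝ), ∃ M > (0 : ℝ),
      ∀ Y Zm X : Matrix (Fin p) (Fin n) ℝ,
        (∃ (W₁ : Matrix (Fin n) (Fin n) ℝ) (W₂ : Matrix (Fin p) (Fin p) ℝ),
          Zm = Xbar * W₁ + W₂ * Xbar) →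
        (∀ W : Matrix (Fin p) (Fin n) ℝ,
          (∃ (W₁ : Matrix (Fin n) (Fin n) ℝ) (W₂ : Matrix (Fin p) (Fin p) ℝ),
            W = Xbar * W₁ + W₂ * Xbar) →
          ∑ i, ∑ j, (Y - Zm) i j * W i j = 0) →
        X.rank ≤ d →
        (∀ W : Matrix (Fin p) (Fin n) ℝ, W.rank ≤ d →
          fnorm (Y - X) ≤ fnorm (Y - W)) →
        fnorm (Zm - Xbar) ≤ δ →
        fnorm (Zm - X) ≤ M * fnorm (Y - Xbar) ^ ((3 : ℝ) / 2) := by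
  let _ := Matrix.frobeniusNormedAddCommGroup (m := Fin p) (n := Fin n) (α := ℝ)
  obtain ⟨ε, hε, c, hc, htan⟩ := exists_tangent_approx Xbar hrank
  obtain ⟨c', hc', hret⟩ := exists_rank_le_approx Xbar hrank
  simp only [fnorm_eq_norm]
  set ρ := min 1 (ε / 2) with hρ
  have hρ0 : 0 < ρ := lt_min one_pos (by linarith)
  set C := 4 * c + c' with hC
  have hC0 : 0 ≤ C := by positivity
  refine ⟨1, one_pos, Real.sqrt (2 * C + C ^ 2) + 4 * c + 2 / Real.sqrt ρ, by positivity, ?_⟩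
  rintro Y Z X ⟨W₁, W₂, hZ⟩ horth hXd hmin -
  set r := ‖Y - Xbar‖ with hr
  have hr0 : 0 ≤ r := norm_nonneg _
  have hr32 : r ^ ((3 : ℝ) / 2) = r * Real.sqrt r := by
    rw [Real.sqrt_eq_rpow, ← Real.rpow_one_add' hr0 (by norm_num)]
    norm_num
  rw [hr32]
  have hpyth : ∀ (V₁ : Matrix (Fin n) (Fin n) ℝ) (V₂ : Matrix (Fin p) (Fin p) ℝ),
      ‖Y - (Xbar * V₁ + V₂ * Xbar)‖ ^ 2 =
        ‖Y - Z‖ ^ 2 + ‖Z - (Xbar * V₁ + V₂ * Xbar)‖ ^ 2 := by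
    intro V₁ V₂
    rw [← frobenius_norm_add_sq (horth (Z - (Xbar * V₁ + V₂ * Xbar))
      ⟨W₁ - V₁, W₂ - V₂, by rw [hZ, Matrix.mul_sub, Matrix.sub_mul]; abel⟩), sub_add_sub_cancel]
  have hp := hpyth 1 0
  rw [Matrix.mul_one, Matrix.zero_mul, add_zero, ← hr] at hp
  have hYZ : ‖Y - Z‖ ≤ r := abs_le_of_sq_le_sq' (by nlinarith [sq_nonneg ‖Z - Xbar‖]) hr0 |>.2
  have hZX : ‖Z - Xbar‖ ≤ r := abs_le_of_sq_le_sq' (by nlinarith [sq_nonneg ‖Y - Z‖]) hr0 |>.2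
  have hYX : ‖Y - X‖ ≤ r := hmin Xbar hrank.le
  have hsr := Real.sqrt_nonneg r
  rcases le_or_gt r ρ with hrρ | hrρ
  · have hr1 : r ≤ 1 := hrρ.trans (min_le_left _ _)
    have hXX : ‖X - Xbar‖ ≤ 2 * r := by
      have := norm_sub_le_norm_sub_add_norm_sub X Y Xbar
      rw [norm_sub_rev X Y] at this
      linarith
    obtain ⟨V₁, V₂, hV⟩ := htan X hXd
      (hXX.trans (by linarith [hrρ.trans (min_le_right 1 (ε / 2))]))
    have hXh : ‖X - (Xbar * V₁ + V₂ * Xbar)‖ ≤ 4 * c * r ^ 2 := by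
      refine hV.trans ?_
      have := pow_le_pow_left₀ (norm_nonneg (X - Xbar)) hXX 2
      nlinarith
    have hp2 := hpyth V₁ V₂
    set h := Xbar * V₁ + V₂ * Xbar with hh
    obtain ⟨V, hVd, hVn⟩ := hret (W₁ - 1) W₂
    have hEZ : Xbar * (W₁ - 1) + W₂ * Xbar = Z - Xbar := by
      rw [hZ, Matrix.mul_sub, Matrix.mul_one]; abel
    rw [hEZ, add_sub_cancel] at hVn
    have hVZ : ‖V - Z‖ ≤ c' * r ^ 2 :=
      hVn.trans (mul_le_mul_of_nonneg_left (pow_le_pow_left₀ (norm_nonneg _) hZX 2) hc')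
    have hYh : ‖Y - h‖ ≤ ‖Y - Z‖ + C * r ^ 2 := by
      have h1 := norm_sub_le_norm_sub_add_norm_sub Y X h
      have h2 := hmin V hVd
      have h3 := norm_sub_le_norm_sub_add_norm_sub Y Z V
      rw [norm_sub_rev Z V] at h3
      rw [hC]
      linarith
    have hsq := pow_le_pow_left₀ (norm_nonneg _) hYh 2
    have hZh2 : ‖Z - h‖ ^ 2 ≤ (2 * C + C ^ 2) * (r ^ 2 * r) := by
      have h1 : ‖Y - Z‖ * (C * r ^ 2) ≤ r * (C * r ^ 2) :=
        mul_le_mul_of_nonneg_right hYZ (by positivity)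
      have h2 : C ^ 2 * r ^ 3 * r ≤ C ^ 2 * r ^ 3 * 1 :=
        mul_le_mul_of_nonneg_left hr1 (by positivity)
      nlinarith
    have hZh : ‖Z - h‖ ≤ Real.sqrt (2 * C + C ^ 2) * (r * Real.sqrt r) := by
      refine (Real.le_sqrt_of_sq_le hZh2).trans (le_of_eq ?_)
      rw [Real.sqrt_mul (by positivity), Real.sqrt_mul (by positivity), Real.sqrt_sq hr0]
    have hrs : r ^ 2 ≤ r * Real.sqrt r := by
      have : r ≤ Real.sqrt r := Real.le_sqrt_of_sq_le (by nlinarith)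
      nlinarith
    have h1 := norm_sub_le_norm_sub_add_norm_sub Z h X
    rw [norm_sub_rev h X] at h1
    have h2 : 4 * c * r ^ 2 ≤ 4 * c * (r * Real.sqrt r) :=
      mul_le_mul_of_nonneg_left hrs (by positivity)
    have h3 : 0 ≤ 2 / Real.sqrt ρ * (r * Real.sqrt r) := by positivity
    linarith
  · have h1 := norm_sub_le_norm_sub_add_norm_sub Z Y X
    rw [norm_sub_rev Z Y] at h1
    have hs : 0 < Real.sqrt ρ := Real.sqrt_pos.mpr hρ0
    have h2 : 1 ≤ Real.sqrt r / Real.sqrt ρ := (one_le_div hs).mpr (Real.sqrt_le_sqrt hrρ.le)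
    have h3 : 2 * r ≤ 2 / Real.sqrt ρ * (r * Real.sqrt r) := by
      calc 2 * r = 2 * r * 1 := by ring
        _ ≤ 2 * r * (Real.sqrt r / Real.sqrt ρ) :=
          mul_le_mul_of_nonneg_left h2 (by positivity)
        _ = _ := by ring
    have h4 : 0 ≤ Real.sqrt (2 * C + C ^ 2) * (r * Real.sqrt r) := by positivity
    have h5 : 0 ≤ 4 * c * (r * Real.sqrt r) := by positivity
    linarith
end
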